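/- For A ∈ K₊ define the conjugate operator TA by (TA)(x,y)z := -A(x,y)(Jz). Then: (i) TA ∈ K₊ (TA is an affine curvature operator that commutes with J and satisfies (TA)(Jx,Jy) = (TA)(x,y)); (ii) T(TA) = -A; and (iii) ρ(TA)(y,z) = -ρ(A)(y,Jz) for all y,z. Consequently T restricts to a linear bijection of K₊ ∩ ker(ρ) onto itself. -/

import Mathlib

open Module

variable {V : Type*} [AddCommGroup V] [Module ℝ V]

/-- `A` is an affine curvature operator. -/
def IsAff (A : V →ₗ[ℝ] V →ₗ[ℝ] V →ₗ[ℝ] V) : Prop :=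
  (∀ x y, A x y = - A y x) ∧ ∀ x y z, A x y z + A y z x + A z x y = 0

/-- The Ricci tensor `ρ(A)(x,y) = Tr (z ↦ A(z,x)y)`. -/
noncomputable def rho (A : V →ₗ[ℝ] V →ₗ[ℝ] V →ₗ[ℝ] V) (x y : V) : ℝ :=
  LinearMap.trace ℝ V ((A.flip x).flip y)

/-- `A` is an affine Kähler curvature operator: `A ∈ 𝔄` and `A(x,y)` commutes with `J`. -/
def IsK (J : V →ₗ[ℝ] V) (A : V →ₗ[ℝ] V →ₗ[ℝ] V →ₗ[ℝ] V) : Prop :=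
  IsAff A ∧ ∀ x y z, A x y (J z) = J (A x y z)

/-- `A ∈ K₊`. -/
def IsKplus (J : V →ₗ[ℝ] V) (A : V →ₗ[ℝ] V →ₗ[ℝ] V →ₗ[ℝ] V) : Prop :=
  IsK J A ∧ ∀ x y, A (J x) (J y) = A x y

/-- for `A ∈ K₊` the conjugate operator `TA`, with
`(TA)(x,y)z = -A(x,y)(Jz)`, satisfies (i) `TA ∈ K₊`, (ii) `T(TA) = -A`, and
(iii) `ρ(TA)(y,z) = -ρ(A)(y,Jz)`; consequently `T` restricts to a linear bijection
of `K₊ ∩ ker ρ` onto itself. -/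
theorem statement17 [FiniteDimensional ℝ V] (J : V →ₗ[ℝ] V) (hJ : ∀ v, J (J v) = -v)
    (A : V →ₗ[ℝ] V →ₗ[ℝ] V →ₗ[ℝ] V) (hA : IsKplus J A)
    (B : V →ₗ[ℝ] V →ₗ[ℝ] V →ₗ[ℝ] V)
    (hB : ∀ x y z, B x y z = - A x y (J z)) :
    IsKplus J B ∧
    (∀ x y z, - B x y (J z) = - A x y z) ∧
    (∀ y z, rho B y z = - rho A y (J z)) ∧
    ((∀ x y, rho A x y = 0) → ∀ x y, rho B x y = 0) := by
  obtain ⟨⟨⟨h1, h2⟩, h3⟩, h4⟩ := hA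
  have h5 : ∀ y z, rho B y z = - rho A y (J z) := by
    intro y z
    unfold rho
    rw [← map_neg]
    congr 1
    ext w
    simp [hB]
  refine ⟨⟨⟨⟨?_, ?_⟩, ?_⟩, ?_⟩, ?_, h5, ?_⟩
  · intro x y
    ext z
    rw [LinearMap.neg_apply, hB, hB, h1 x y, LinearMap.neg_apply]
  · intro x y z
    rw [hB, hB, hB, h3, h3, h3, ← neg_add, ← neg_add, ← map_add, ← map_add, h2, map_zero, neg_zero]
  · intro x y z
    rw [hB, hB, h3 x y (J z), map_neg]
  · intro x y
    ext z
    rw [hB, hB, h4]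
  · intro x y z
    rw [hB, hJ, map_neg, neg_neg]
  · intro h x y
    rw [h5, h, neg_zero]
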